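/- There exists b̄ > 0 (e.g., b̄ = √(2/(π e²⁵))) such that for every b ∈ (0, b̄], the solution γ_b of γ''/(1+(γ')²) = (x/2 - 1/x)·γ' - γ/2 with γ_b(0) = b, γ_b'(0) = 0 satisfies: its blow-up point x₊(b) obeys x₊(b) ≥ √(log(2/(πb²))), the blow-up value z₊(b) = lim_{x→x₊} γ_b(x) obeys -12/√(log(2/(πb²))) ≤ z₊(b) < 0, and there exists x_c(b) ∈ [2, 2√2] with γ_b(x_c(b)) = 0. -/

import Mathlib

open Set Real Filter

noncomputable def cc (u : ℝ) : ℝ := 1 / √(1 + u ^ 2)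

noncomputable def ss (u : ℝ) : ℝ := -u * cc u

lemma cc_pos (u : ℝ) : 0 < cc u := by unfold cc; positivity

lemma cc_sq (u : ℝ) : cc u ^ 2 * (1 + u ^ 2) = 1 := by
  unfold cc
  rw [div_pow, Real.sq_sqrt (by positivity)]
  field_simp

lemma cc_le_one (u : ℝ) : cc u ≤ 1 := by
  have h1 := cc_sq u
  have h2 := cc_pos u
  nlinarith [sq_nonneg (cc u * u)]

lemma ss_sq (u : ℝ) : ss u ^ 2 + cc u ^ 2 = 1 := by
  unfold ss
  linarith [cc_sq u]

lemma abs_ss_le (u : ℝ) : |ss u| ≤ 1 := by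
  rw [abs_le]
  constructor <;> nlinarith [ss_sq u, sq_nonneg (cc u)]

lemma ss_hasDerivAt (u : ℝ → ℝ) (u' x : ℝ) (h : HasDerivAt u u' x) :
    HasDerivAt (fun x => ss (u x)) (-(u' * cc (u x) ^ 3)) x := by
  have h1 : HasDerivAt (fun x => 1 + u x ^ 2) (2 * u x * u') x := by
    refine ((h.pow 2).const_add 1).congr_deriv ?_
    norm_num
  have hpos : 0 < 1 + u x ^ 2 := by positivity
  have h2 := h1.sqrt hpos.ne'
  have h3 := (h.neg).div h2 (by positivity)
  have e : (fun x => ss (u x)) = (fun x => (-u x) / √(1 + u x ^ 2)) := by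
    funext y; simp only [ss, cc]; ring
  rw [e]
  refine h3.congr_deriv ?_
  unfold cc
  have hs : √(1 + u x ^ 2) ^ 2 = 1 + u x ^ 2 := Real.sq_sqrt hpos.le
  have hs0 : 0 < √(1 + u x ^ 2) := by positivity
  set r := √(1 + u x ^ 2)
  simp only [Pi.neg_apply]
  field_simp
  linear_combination (-u') * hs

structure Sol (y u u' : ℝ → ℝ) (b xp : ℝ) : Prop where
  hxp : √2 < xp
  hb : 0 < b
  hb' : b ≤ exp (-20)
  y0 : y 0 = b
  cont : ContinuousOn y (Ico 0 xp)
  dy : ∀ x ∈ Ioo 0 xp, HasDerivAt y (u x) x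
  du : ∀ x ∈ Ioo 0 xp, HasDerivAt u (u' x) x
  ode : ∀ x ∈ Ioo 0 xp, u' x = (1 + u x ^ 2) * ((x / 2 - 1 / x) * u x - y x / 2)
  uneg : ∀ x ∈ Ioo 0 xp, u x < 0
  u'neg : ∀ x ∈ Ioo 0 xp, u' x < 0
  lim : Tendsto u (nhdsWithin xp (Iio xp)) atBot

section
variable {y u u' : ℝ → ℝ} {b xp : ℝ}

lemma Sol.xppos (h : Sol y u u' b xp) : 0 < xp := lt_trans (Real.sqrt_pos.2 (by norm_num)) h.hxp

lemma Sol.dS (h : Sol y u u' b xp) (x : ℝ) (hx : x ∈ Ioo 0 xp) :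
    HasDerivAt (fun x => x * ss (u x))
      (x ^ 2 / 2 * ss (u x) + x * y x * cc (u x) / 2) x := by
  have h1 := (hasDerivAt_id x).mul (ss_hasDerivAt u (u' x) x (h.du x hx))
  refine h1.congr_deriv ?_
  have hx0 := hx.1.ne'
  simp only [id]
  rw [h.ode x hx]
  have e := cc_sq (u x)
  have e2 : (1 + u x ^ 2) * ((x / 2 - 1 / x) * u x - y x / 2) * cc (u x) ^ 3
    = ((x / 2 - 1 / x) * u x - y x / 2) * cc (u x) := by
    linear_combination ((x / 2 - 1 / x) * u x - y x / 2) * cc (u x) * e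
  rw [e2]
  unfold ss
  field_simp
  ring

lemma Sol.contS (h : Sol y u u' b xp) : ContinuousOn (fun x => x * ss (u x)) (Ico 0 xp) := by
  intro x hx
  rcases eq_or_lt_of_le hx.1 with h0 | h0
  · subst h0
    apply ContinuousAt.continuousWithinAt
    unfold ContinuousAt
    simp only [zero_mul]
    apply squeeze_zero_norm (a := fun x => |x|)
    · intro t
      rw [norm_mul, Real.norm_eq_abs, Real.norm_eq_abs]
      nlinarith [abs_nonneg t, abs_ss_le (u t)]
    · have : Continuous fun x : ℝ => |x| := continuous_abs
      simpa using this.tendsto 0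
  · exact (h.dS x ⟨h0, hx.2⟩).continuousAt.continuousWithinAt

lemma Sol.anti (h : Sol y u u' b xp) : StrictAntiOn y (Ico 0 xp) := by
  apply strictAntiOn_of_deriv_neg (convex_Ico _ _) h.cont
  intro x hx
  rw [interior_Ico] at hx
  rw [(h.dy x hx).deriv]
  exact h.uneg x hx

lemma Sol.y_le (h : Sol y u u' b xp) (x : ℝ) (hx : x ∈ Ioo 0 xp) : y x ≤ b := by
  rw [← h.y0]
  exact (h.anti ⟨le_rfl, h.xppos⟩ ⟨hx.1.le, hx.2⟩ hx.1).le

lemma dexp (x : ℝ) : HasDerivAt (fun x : ℝ => exp (-(x ^ 2 / 4))) (-(x / 2) * exp (-(x ^ 2 / 4))) x := by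
  have := ((((hasDerivAt_id x).pow 2).div_const 4).neg).exp
  refine this.congr_deriv ?_
  simp [id]; ring

lemma Sol.sbound (h : Sol y u u' b xp) (x : ℝ) (hx : x ∈ Ioo 0 xp) :
    x * ss (u x) ≤ b * (exp (x ^ 2 / 4) - 1) := by
  let F : ℝ → ℝ := fun x => exp (-(x ^ 2 / 4)) * (x * ss (u x)) + b * exp (-(x ^ 2 / 4))
  have hd : ∀ x ∈ Ioo 0 xp, HasDerivAt F (exp (-(x ^ 2 / 4)) * (x / 2) * (y x * cc (u x) - b)) x := by
    intro x hx
    refine (((dexp x).mul (h.dS x hx)).add ((dexp x).const_mul b)).congr_deriv ?_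
    ring
  have hc : ContinuousOn F (Ico 0 xp) := by
    apply ContinuousOn.add
    · exact ContinuousOn.mul (by fun_prop) h.contS
    · fun_prop
  have ha : AntitoneOn F (Ico 0 xp) := by
    apply antitoneOn_of_deriv_nonpos (convex_Ico _ _) hc
    · intro x hx
      rw [interior_Ico] at hx
      exact (hd x hx).differentiableAt.differentiableWithinAt
    · intro x hx
      rw [interior_Ico] at hx
      rw [(hd x hx).deriv]
      have h1 := h.y_le x hx
      have h2 := cc_pos (u x)
      have h3 := cc_le_one (u x)
      have h4 := h.hb
      have h5 : y x * cc (u x) - b ≤ 0 := by nlinarith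
      have h6 : 0 ≤ exp (-(x ^ 2 / 4)) * (x / 2) := by have := hx.1; positivity
      exact mul_nonpos_of_nonneg_of_nonpos h6 h5
  have h1 := ha ⟨le_rfl, h.xppos⟩ ⟨hx.1.le, hx.2⟩ hx.1.le
  simp only [F] at h1
  have h2 : exp (-(x ^ 2 / 4)) * exp (x ^ 2 / 4) = 1 := by rw [← exp_add]; simp
  have h3 := mul_le_mul_of_nonneg_right h1 (exp_pos (x ^ 2 / 4)).le
  simp at h3
  have h4 : (exp (-(x ^ 2 / 4)) * (x * ss (u x)) + b * exp (-(x ^ 2 / 4))) * exp (x ^ 2 / 4)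
    = x * ss (u x) + b := by linear_combination (x * ss (u x) + b) * h2
  rw [h4] at h3
  linarith

lemma Sol.ss_pos (h : Sol y u u' b xp) (x : ℝ) (hx : x ∈ Ioo 0 xp) : 0 < ss (u x) := by
  unfold ss
  have := h.uneg x hx
  have := cc_pos (u x)
  nlinarith

lemma Sol.x1 (h : Sol y u u' b xp) :
    ∃ x ∈ Ioo 0 xp, u x = -1 ∧ 1 ≤ b * exp (x ^ 2 / 4) := by
  have hkey : ∀ x ∈ Ioo 0 xp, √2 ≤ x → u x ≤ -1 → 1 ≤ b * (exp (x ^ 2 / 4) - 1) := by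
    intro x hx h2 hu
    have h1 := h.sbound x hx
    have hs : 1 / 2 ≤ ss (u x) ^ 2 := by
      have := cc_sq (u x)
      unfold ss
      nlinarith [sq_nonneg (cc (u x)), mul_nonneg (sq_nonneg (cc (u x))) (by nlinarith : 0 ≤ u x ^ 2 - 1)]
    have h3 : 1 ≤ x * ss (u x) := by
      have h4 := h.ss_pos x hx
      have h5 : 2 ≤ x ^ 2 := by
        have := Real.sq_sqrt (show (0:ℝ) ≤ 2 by norm_num)
        nlinarith [Real.sqrt_nonneg 2]
      have h6 : 1 ≤ (x * ss (u x)) ^ 2 := by rw [mul_pow]; nlinarith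
      have h7 : 0 < x * ss (u x) := mul_pos hx.1 h4
      nlinarith
    linarith
  have hs2 : 0 < √2 := by positivity
  have hmem : √2 ∈ Ioo 0 xp := ⟨hs2, h.hxp⟩
  have hlow : -1 < u (√2) := by
    by_contra hcon
    push Not at hcon
    have h1 := hkey _ hmem le_rfl hcon
    rw [Real.sq_sqrt (by norm_num)] at h1
    have h2 : exp ((2:ℝ) / 4) ≤ exp 1 := exp_le_exp.2 (by norm_num)
    have h3 := exp_one_lt_d9
    have h4 : b ≤ 1 / 2 := by
      refine h.hb'.trans ?_
      rw [exp_neg]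
      have := add_one_le_exp (20:ℝ)
      rw [inv_le_comm₀ (exp_pos _) (by norm_num)]
      linarith
    nlinarith [h.hb]
  obtain ⟨x2, hx2, hx2u⟩ : ∃ x2, x2 ∈ Ioo (√2) xp ∧ u x2 < -1 := by
    have e1 := h.lim.eventually (eventually_lt_atBot (-1))
    have e2 : ∀ᶠ x in nhdsWithin xp (Iio xp), x ∈ Ioo (√2) xp := Ioo_mem_nhdsLT h.hxp
    have : (nhdsWithin xp (Iio xp)).NeBot := inferInstance
    exact (e2.and e1).exists
  have hcont : ContinuousOn u (Icc (√2) x2) := by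
    intro x hx
    exact (h.du x ⟨hs2.trans_le hx.1, hx.2.trans_lt hx2.2⟩).continuousAt.continuousWithinAt
  obtain ⟨x, hx, hxu⟩ := intermediate_value_Icc' hx2.1.le hcont ⟨hx2u.le, hlow.le⟩
  have hx' : x ∈ Ioo 0 xp := ⟨hs2.trans_le hx.1, hx.2.trans_lt hx2.2⟩
  refine ⟨x, hx', hxu, ?_⟩
  have := hkey x hx' hx.1 hxu.le
  nlinarith [h.hb]

lemma x1_large (hb : 0 < b) (hb' : b ≤ exp (-20)) (x : ℝ) (h : 1 ≤ b * exp (x ^ 2 / 4)) :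
    80 ≤ x ^ 2 ∧ Real.log (2 / (π * b ^ 2)) ≤ x ^ 2 := by
  constructor
  · have : 1 ≤ exp (-20) * exp (x ^ 2 / 4) :=
      h.trans (mul_le_mul_of_nonneg_right hb' (exp_pos _).le)
    rw [← exp_add, one_le_exp_iff] at this
    linarith
  · have hpi := pi_gt_three
    rw [Real.log_le_iff_le_exp (by positivity)]
    have e : exp (x ^ 2 / 4) ^ 2 ≤ exp (x ^ 2) := by
      rw [← exp_nat_mul]
      apply exp_le_exp.2
      push_cast
      nlinarith [sq_nonneg x]
    refine le_trans ?_ e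
    rw [div_le_iff₀ (by positivity)]
    have h2 : 1 ≤ (b * exp (x ^ 2 / 4)) ^ 2 := one_le_pow₀ h
    nlinarith

lemma L_pos (hb : 0 < b) (hb' : b ≤ exp (-20)) : 0 < Real.log (2 / (π * b ^ 2)) := by
  apply Real.log_pos
  have hpi := pi_lt_d2
  have hpi0 := pi_pos
  have h4 : b ≤ 1 / 2 := by
    refine hb'.trans ?_
    rw [exp_neg]
    have := add_one_le_exp (20:ℝ)
    rw [inv_le_comm₀ (exp_pos _) (by norm_num)]
    linarith
  rw [lt_div_iff₀ (by positivity)]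
  have : b ^ 2 ≤ 1 / 4 := by nlinarith
  nlinarith [sq_nonneg b]

lemma Sol.xp_large (h : Sol y u u' b xp) : 8 < xp := by
  obtain ⟨x, hx, _, h1⟩ := h.x1
  have := (x1_large h.hb h.hb' x h1).1
  have := hx.1
  have := hx.2
  nlinarith

lemma Sol.uanti (h : Sol y u u' b xp) : StrictAntiOn u (Ioo 0 xp) := by
  apply strictAntiOn_of_deriv_neg (convex_Ioo _ _)
  · intro x hx
    exact (h.du x hx).continuousAt.continuousWithinAt
  intro x hx
  rw [interior_Ioo] at hx
  rw [(h.du x hx).deriv]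
  exact h.u'neg x hx

lemma exp_chord (t : ℝ) (h0 : 0 ≤ t) (h1 : t ≤ 1) : exp t - 1 ≤ 1.72 * t := by
  have := convexOn_exp.2 (mem_univ 0) (mem_univ 1) (by linarith : 0 ≤ 1 - t) h0 (by ring)
  simp at this
  nlinarith [exp_one_lt_d9]

lemma small_b (hb' : b ≤ exp (-20)) : b * exp 2 ≤ 1 / 10 := by
  have h1 : b * exp 2 ≤ exp (-20) * exp 2 := mul_le_mul_of_nonneg_right hb' (exp_pos _).le
  rw [← exp_add] at h1
  refine h1.trans ?_
  have : (-20 + 2 : ℝ) = -18 := by norm_num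
  rw [this, exp_neg]
  have := add_one_le_exp (18:ℝ)
  rw [inv_le_comm₀ (exp_pos _) (by norm_num)]
  linarith

lemma one_sub_cc_le (u : ℝ) : 1 - cc u ≤ ss u ^ 2 := by
  nlinarith [ss_sq u, cc_pos u, cc_le_one u]

lemma Sol.ss_small (h : Sol y u u' b xp) (x : ℝ) (hx : x ∈ Ioo 0 xp) (hx8 : x ^ 2 ≤ 8) :
    ss (u x) ≤ 1 / 10 * (x / 4) := by
  have h1 := h.sbound x hx
  have hs := small_b h.hb'
  have hx0 := hx.1
  have h2 : exp (x ^ 2 / 4) - 1 ≤ x ^ 2 / 4 * exp (x ^ 2 / 4) := by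
    have a := add_one_le_exp (-(x ^ 2 / 4))
    have e : exp (-(x ^ 2 / 4)) * exp (x ^ 2 / 4) = 1 := by rw [← exp_add]; simp
    nlinarith [exp_pos (x ^ 2 / 4)]
  have h3 : exp (x ^ 2 / 4) ≤ exp 2 := exp_le_exp.2 (by linarith)
  have h4 : x ^ 2 / 4 * exp (x ^ 2 / 4) ≤ x ^ 2 / 4 * exp 2 :=
    mul_le_mul_of_nonneg_left h3 (by positivity)
  have h5 : b * (exp (x ^ 2 / 4) - 1) ≤ b * (x ^ 2 / 4 * exp 2) :=
    mul_le_mul_of_nonneg_left (h2.trans h4) h.hb.le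
  have h6 : b * (x ^ 2 / 4 * exp 2) ≤ x ^ 2 / 4 * (1 / 10) := by
    have := mul_le_mul_of_nonneg_left hs (by positivity : 0 ≤ x ^ 2 / 4)
    linarith
  have h7 : x * ss (u x) ≤ x * (1 / 10 * (x / 4)) := by linarith
  exact le_of_mul_le_mul_left h7 hx0

lemma Sol.y2pos (h : Sol y u u' b xp) : 0 < y 2 := by
  have hxp := h.xp_large
  have hd : ∀ x ∈ Ioo (0:ℝ) 2, HasDerivAt (fun x => y x + 1.8 * b * x ^ 2 / 8)
      (u x + 1.8 * b * x / 4) x := by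
    intro x hx
    have h1 := (((hasDerivAt_id x).pow 2).const_mul (1.8 * b)).div_const 8
    refine ((h.dy x ⟨hx.1, by linarith [hx.2]⟩).add h1).congr_deriv ?_
    simp [id]; ring
  have hm : MonotoneOn (fun x => y x + 1.8 * b * x ^ 2 / 8) (Icc 0 2) := by
    apply monotoneOn_of_deriv_nonneg (convex_Icc _ _)
    · apply ContinuousOn.add (h.cont.mono (fun x hx => ⟨hx.1, by linarith [hx.2]⟩))
      fun_prop
    · intro x hx
      rw [interior_Icc] at hx
      exact (hd x hx).differentiableAt.differentiableWithinAt
    · intro x hx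
      rw [interior_Icc] at hx
      rw [(hd x hx).deriv]
      have hx' : x ∈ Ioo 0 xp := ⟨hx.1, by linarith [hx.2]⟩
      have hx0 := hx.1
      have hx2 := hx.2
      have h1 := h.sbound x hx'
      have h2 := h.ss_small x hx' (by nlinarith)
      have h3 := one_sub_cc_le (u x)
      have h4 := h.ss_pos x hx'
      have h5 : ss (u x) ≤ 1 / 20 := by linarith
      have h6 : 0.99 ≤ cc (u x) := by nlinarith
      have h7 := exp_chord (x ^ 2 / 4) (by positivity) (by nlinarith)
      have h8 : x * ss (u x) ≤ b * (1.72 * (x ^ 2 / 4)) :=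
        h1.trans (mul_le_mul_of_nonneg_left h7 h.hb.le)
      have h9 : ss (u x) ≤ 1.72 * b * (x / 4) := by
        have : x * ss (u x) ≤ x * (1.72 * b * (x / 4)) := by linarith
        exact le_of_mul_le_mul_left this hx0
      have h10 : ss (u x) = -u x * cc (u x) := rfl
      have h11 := h.uneg x hx'
      have h12 : 0.99 * (-u x) ≤ 1.72 * b * (x / 4) := by nlinarith
      have h13 : 0 < b * (x / 4) := by have := h.hb; positivity
      linarith
  have := hm (⟨le_rfl, by norm_num⟩ : (0:ℝ) ∈ Icc (0:ℝ) 2) (⟨by norm_num, le_rfl⟩) (by norm_num)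
  simp only [h.y0] at this
  have hb := h.hb
  linarith

lemma Sol.ya (h : Sol y u u' b xp) : y (2 * √2) ≤ 0 := by
  have hxp := h.xp_large
  have h2 : √2 ^ 2 = 2 := Real.sq_sqrt (by norm_num)
  have h20 : 0 < √2 := by positivity
  set a := 2 * √2 with ha
  have ha2 : a ^ 2 = 8 := by rw [ha, mul_pow, h2]; norm_num
  have ha0 : 0 < a := by positivity
  have haxp : a < xp := by nlinarith
  by_contra hcon
  push Not at hcon
  let W : ℝ → ℝ := fun x => exp (-(x ^ 2 / 4)) * ((x * ss (u x)) * (1 - x ^ 2 / 8) - y x * (x ^ 2 / 4))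
  have hd : ∀ x ∈ Ioo 0 xp, HasDerivAt W (exp (-(x ^ 2 / 4)) *
      (x * y x * (x ^ 2 / 16 - (1 - cc (u x)) * (1 - x ^ 2 / 8) / 2) +
        x * (x / 4) * (-u x) * (1 - cc (u x)))) x := by
    intro x hx
    have p2 : HasDerivAt (fun x : ℝ => x ^ 2) (2 * x) x := by
      simpa using (hasDerivAt_pow 2 x)
    refine ((dexp x).mul (((h.dS x hx).mul ((p2.div_const 8).const_sub 1)).sub
      ((h.dy x hx).mul (p2.div_const 4)))).congr_deriv ?_
    simp only [Pi.mul_apply, Pi.sub_apply]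
    unfold ss
    ring
  have hc : ContinuousOn W (Icc 0 a) := by
    have hsub : Icc 0 a ⊆ Ico 0 xp := fun x hx => ⟨hx.1, hx.2.trans_lt haxp⟩
    apply ContinuousOn.mul (by fun_prop)
    apply ContinuousOn.sub
    · exact (h.contS.mono hsub).mul (by fun_prop)
    · exact (h.cont.mono hsub).mul (by fun_prop)
  have hm : MonotoneOn W (Icc 0 a) := by
    apply monotoneOn_of_deriv_nonneg (convex_Icc _ _) hc
    · intro x hx
      rw [interior_Icc] at hx
      exact (hd x ⟨hx.1, hx.2.trans haxp⟩).differentiableAt.differentiableWithinAt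
    · intro x hx
      rw [interior_Icc] at hx
      have hx' : x ∈ Ioo 0 xp := ⟨hx.1, hx.2.trans haxp⟩
      rw [(hd x hx').deriv]
      have hx0 := hx.1
      have hx8 : x ^ 2 ≤ 8 := by nlinarith [hx.2]
      have h3 := one_sub_cc_le (u x)
      have h4 := h.ss_pos x hx'
      have h5 := h.ss_small x hx' hx8
      have h6 : 1 - cc (u x) ≤ x ^ 2 / 16 := by nlinarith
      have h7 := cc_le_one (u x)
      have h8 := h.uneg x hx'
      have hy : 0 < y x := hcon.trans (h.anti ⟨hx0.le, hx'.2⟩ ⟨ha0.le, haxp⟩ hx.2)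
      have h9 : 0 ≤ x ^ 2 / 16 - (1 - cc (u x)) * (1 - x ^ 2 / 8) / 2 := by
        nlinarith [mul_nonneg (sub_nonneg.2 h7) (sq_nonneg x)]
      have h10 : 0 ≤ x * y x * (x ^ 2 / 16 - (1 - cc (u x)) * (1 - x ^ 2 / 8) / 2) :=
        mul_nonneg (by positivity) h9
      have h11 : 0 ≤ x * (x / 4) * (-u x) * (1 - cc (u x)) :=
        mul_nonneg (mul_nonneg (by positivity) (by linarith)) (by linarith)
      exact mul_nonneg (exp_pos _).le (by linarith)
  have h1 := hm ⟨le_rfl, ha0.le⟩ ⟨ha0.le, le_rfl⟩ ha0.le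
  simp only [W, ha2] at h1
  norm_num at h1
  have h3 := exp_pos (-2:ℝ)
  nlinarith

lemma Sol.hbound_small (h : Sol y u u' b xp) (x : ℝ) (h2 : 2 < x) (h4 : x ≤ 4) :
    0 ≤ x * y x - 8 * u x := by
  have hxp := h.xp_large
  have hy2 := h.y2pos
  have hx' : x ∈ Ioo 0 xp := ⟨by linarith, by linarith⟩
  obtain ⟨ξ, hξ, he⟩ := exists_hasDerivAt_eq_slope y u h2
    (h.cont.mono (fun t ht => ⟨by linarith [ht.1], by linarith [ht.2]⟩))
    (fun t ht => h.dy t ⟨by linarith [ht.1], by linarith [ht.2]⟩)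
  have h5 := h.uanti (⟨by linarith [hξ.1], by linarith [hξ.2]⟩ : ξ ∈ Ioo 0 xp) hx' hξ.2
  rw [eq_div_iff (by linarith)] at he
  have h6 := h.uneg x hx'
  have h7 : u x * (x - 2) ≤ y x := by nlinarith
  have h8 : x * (u x * (x - 2)) ≤ x * y x := mul_le_mul_of_nonneg_left h7 (by linarith)
  have h9 : 0 ≤ (-u x) * ((4 - x) * (x + 2)) :=
    mul_nonneg (by linarith) (mul_nonneg (by linarith) (by linarith))
  nlinarith

lemma Sol.hbound (h : Sol y u u' b xp) (x : ℝ) (h4 : 4 ≤ x) (hx : x < xp) :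
    0 ≤ x * y x - 8 * u x := by
  have hd : ∀ x ∈ Ico 4 xp, HasDerivAt (fun x => (x * y x - 8 * u x) / x ^ 5)
      (((y x + x * u x - 8 * u' x) * x ^ 5 - (x * y x - 8 * u x) * (5 * x ^ 4)) / (x ^ 5) ^ 2) x := by
    intro x hx
    have hx' : x ∈ Ioo 0 xp := ⟨by linarith [hx.1], hx.2⟩
    have p5 : HasDerivAt (fun x : ℝ => x ^ 5) (5 * x ^ 4) x := by
      simpa using (hasDerivAt_pow 5 x)
    refine ((((hasDerivAt_id x).mul (h.dy x hx')).sub ((h.du x hx').const_mul 8)).div p5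
      (pow_ne_zero _ hx'.1.ne')).congr_deriv ?_
    simp [id]
  have hm : MonotoneOn (fun x => (x * y x - 8 * u x) / x ^ 5) (Ico 4 xp) := by
    apply monotoneOn_of_deriv_nonneg (convex_Ico _ _)
    · intro x hx
      exact (hd x hx).continuousAt.continuousWithinAt
    · intro x hx
      rw [interior_Ico] at hx
      exact (hd x ⟨hx.1.le, hx.2⟩).differentiableAt.differentiableWithinAt
    · intro x hx
      rw [interior_Ico] at hx
      rw [(hd x ⟨hx.1.le, hx.2⟩).deriv]
      have hx4 := hx.1
      have hx' : x ∈ Ioo 0 xp := ⟨by linarith [hx.1], hx.2⟩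
      have hx0 := hx'.1
      apply div_nonneg _ (by positivity)
      have hode := h.ode x hx'
      have hneg := h.u'neg x hx'
      have hun := h.uneg x hx'
      set B := (x / 2 - 1 / x) * u x - y x / 2 with hB
      have hBneg : B < 0 := by
        by_contra hcon
        push Not at hcon
        have := mul_nonneg (by positivity : 0 ≤ 1 + u x ^ 2) hcon
        linarith
      have h1 : u' x ≤ B := by nlinarith [mul_nonneg (sq_nonneg (u x)) (neg_nonneg.2 hBneg.le)]
      have hxB : x * B = (x ^ 2 / 2 - 1) * u x - x * y x / 2 := by
        rw [hB]; field_simp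
      have h2 : x * u' x ≤ (x ^ 2 / 2 - 1) * u x - x * y x / 2 := by
        rw [← hxB]; exact mul_le_mul_of_nonneg_left h1 hx0.le
      have h3 : 0 ≤ x * (y x + x * u x - 8 * u' x) - 5 * (x * y x - 8 * u x) := by
        have h16 : 0 ≤ (x ^ 2 - 16) * (-u x) := mul_nonneg (by nlinarith) (by linarith)
        nlinarith
      have := mul_nonneg (by positivity : 0 ≤ x ^ 4) h3
      linarith
  have h1 := hm ⟨le_rfl, by linarith⟩ ⟨h4, hx⟩ h4
  simp only at h1
  have h2 := h.hbound_small 4 (by norm_num) le_rfl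
  have h3 : 0 ≤ (x * y x - 8 * u x) / x ^ 5 := le_trans (by positivity) h1
  have hx5 : 0 < x ^ 5 := by positivity
  have := mul_nonneg h3 hx5.le
  rwa [div_mul_cancel₀ _ hx5.ne'] at this

lemma Sol.lower (h : Sol y u u' b xp) : ∃ x1, √(Real.log (2 / (π * b ^ 2))) ≤ x1 ∧ x1 < xp ∧
    ∀ x, x1 ≤ x → x < xp → -12 / x1 ≤ y x := by
  obtain ⟨x1, hx1, hu1, hb1⟩ := h.x1
  obtain ⟨h80, hL⟩ := x1_large h.hb h.hb' x1 hb1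
  have hx10 := hx1.1
  have hx4 : 4 ≤ x1 := by nlinarith
  refine ⟨x1, Real.sqrt_le_iff.2 ⟨hx10.le, hL⟩, hx1.2, ?_⟩
  intro z hz1 hz2
  have hd : ∀ x ∈ Ico x1 xp, HasDerivAt (fun x => -y x + 4 / x1 * arctan (u x))
      (-u x + 4 / x1 * (1 / (1 + u x ^ 2) * u' x)) x := by
    intro x hx
    have hx' : x ∈ Ioo 0 xp := ⟨by linarith [hx.1], hx.2⟩
    exact (h.dy x hx').neg.add ((h.du x hx').arctan.const_mul (4 / x1))
  have hm : AntitoneOn (fun x => -y x + 4 / x1 * arctan (u x)) (Ico x1 xp) := by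
    apply antitoneOn_of_deriv_nonpos (convex_Ico _ _)
    · intro x hx
      exact (hd x hx).continuousAt.continuousWithinAt
    · intro x hx
      rw [interior_Ico] at hx
      exact (hd x ⟨hx.1.le, hx.2⟩).differentiableAt.differentiableWithinAt
    · intro x hx
      rw [interior_Ico] at hx
      rw [(hd x ⟨hx.1.le, hx.2⟩).deriv]
      have hxx := hx.1
      have hx' : x ∈ Ioo 0 xp := ⟨by linarith [hx.1], hx.2⟩
      have hx0 := hx'.1
      have hh := h.hbound x (by linarith) hx.2
      have hun := h.uneg x hx'
      rw [h.ode x hx']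
      have e : 1 / (1 + u x ^ 2) * ((1 + u x ^ 2) * ((x / 2 - 1 / x) * u x - y x / 2))
        = (x / 2 - 1 / x) * u x - y x / 2 := by field_simp
      rw [e]
      set B := (x / 2 - 1 / x) * u x - y x / 2 with hB
      have hxB : x * B = (x ^ 2 / 2 - 1) * u x - x * y x / 2 := by
        rw [hB]; field_simp
      have h1 : x * B ≤ x * (x / 4 * u x) := by
        have : 0 ≤ (x ^ 2 - 20) * (-u x) := mul_nonneg (by nlinarith) (by linarith)
        nlinarith
      have h2 : B ≤ x / 4 * u x := le_of_mul_le_mul_left h1 hx0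
      have h3 : B ≤ x1 / 4 * u x := by nlinarith
      have h4 : 4 / x1 * B ≤ 4 / x1 * (x1 / 4 * u x) :=
        mul_le_mul_of_nonneg_left h3 (by positivity)
      have h5 : 4 / x1 * (x1 / 4 * u x) = u x := by field_simp
      linarith
  have h1 := hm ⟨le_rfl, hx1.2⟩ ⟨hz1, hz2⟩ hz1
  simp only [hu1, arctan_neg, arctan_one] at h1
  have h2 := neg_pi_div_two_lt_arctan (u z)
  have h3 := h.hbound x1 hx4 hx1.2
  rw [hu1] at h3
  have h4 := pi_lt_d2
  have hq : 0 < 4 / x1 := by positivity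
  have h5 : -8 / x1 ≤ y x1 := by
    rw [div_le_iff₀ hx10]; linarith
  have h6 : 4 / x1 * (-(π / 2)) ≤ 4 / x1 * arctan (u z) := mul_le_mul_of_nonneg_left h2.le hq.le
  have h7 : 4 / x1 * (π / 4) ≤ 4 / x1 * 1 := mul_le_mul_of_nonneg_left (by linarith) hq.le
  have e1 : -12 / x1 = -3 * (4 / x1) := by ring
  have e2 : -8 / x1 = -2 * (4 / x1) := by ring
  rw [e1]
  rw [e2] at h5
  linarith

end

theorem stmt_9 :
    ∃ bbar : ℝ, 0 < bbar ∧
      ∀ b ∈ Ioc (0 : ℝ) bbar, ∀ (γ : ℝ → ℝ) (xp zp : ℝ),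
        ContDiffOn ℝ 2 γ (Ico 0 xp) →
        (∀ x ∈ Ioo 0 xp,
          deriv (deriv γ) x / (1 + (deriv γ x) ^ 2) = (x / 2 - 1 / x) * deriv γ x - γ x / 2) →
        γ 0 = b → deriv γ 0 = 0 →
        (∀ x ∈ Ioo 0 xp, deriv γ x < 0) →
        (∀ x ∈ Ioo 0 xp, deriv (deriv γ) x < 0) →
        Real.sqrt 2 < xp →
        Tendsto (deriv γ) (nhdsWithin xp (Iio xp)) atBot →
        Tendsto γ (nhdsWithin xp (Iio xp)) (nhds zp) →
        Real.sqrt (Real.log (2 / (π * b ^ 2))) ≤ xp ∧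
          -12 / Real.sqrt (Real.log (2 / (π * b ^ 2))) ≤ zp ∧ zp < 0 ∧
          ∃ x_c ∈ Icc (2 : ℝ) (2 * Real.sqrt 2), γ x_c = 0 := by
  refine ⟨exp (-20), exp_pos _, ?_⟩
  intro b hb γ xp zp hC hode h0 _ hneg hneg2 hxp hlim hlimz
  have hC' : ContDiffOn ℝ 2 γ (Ioo 0 xp) := hC.mono Ioo_subset_Ico_self
  have hsol : Sol γ (deriv γ) (deriv (deriv γ)) b xp := by
    refine ⟨hxp, hb.1, hb.2, h0, hC.continuousOn, ?_, ?_, ?_, hneg, hneg2, hlim⟩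
    · intro x hx
      exact ((hC'.differentiableOn (by norm_num)).differentiableAt
        (isOpen_Ioo.mem_nhds hx)).hasDerivAt
    · intro x hx
      exact (differentiableAt_of_deriv_ne_zero (hneg2 x hx).ne).hasDerivAt
    · intro x hx
      have := hode x hx
      rw [div_eq_iff (by positivity)] at this
      linarith
  have hx8 := hsol.xp_large
  have h2 : √2 ^ 2 = 2 := Real.sq_sqrt (by norm_num)
  have h20 : 0 < √2 := by positivity
  have ha2 : 2 * √2 < 3 := by nlinarith
  have ha1 : 2 ≤ 2 * √2 := by nlinarith
  obtain ⟨x1, hL1, hx1, hlow⟩ := hsol.lower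
  have hLpos := Real.sqrt_pos.2 (L_pos hb.1 hb.2)
  refine ⟨hL1.trans hx1.le, ?_, ?_, ?_⟩
  · have h3 : -12 / x1 ≤ zp := by
      apply ge_of_tendsto hlimz
      filter_upwards [Ioo_mem_nhdsLT hx1] with x hx
      exact hlow x hx.1.le hx.2
    refine le_trans ?_ h3
    rw [neg_div, neg_div]
    exact neg_le_neg (div_le_div_of_nonneg_left (by norm_num) hLpos hL1)
  · have h3 : zp ≤ γ 4 := by
      apply le_of_tendsto hlimz
      filter_upwards [Ioo_mem_nhdsLT (show (4:ℝ) < xp by linarith)] with x hx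
      exact (hsol.anti ⟨by norm_num, by linarith⟩ ⟨by linarith [hx.1], hx.2⟩ hx.1).le
    have h4 : γ 4 < γ (2 * √2) :=
      hsol.anti ⟨by linarith, by linarith⟩ ⟨by norm_num, by linarith⟩ (by linarith)
    linarith [hsol.ya]
  · have hcont : ContinuousOn γ (Icc 2 (2 * √2)) :=
      hC.continuousOn.mono (fun x hx => ⟨by linarith [hx.1], by linarith [hx.2]⟩)
    obtain ⟨x, hx, hx0⟩ := intermediate_value_Icc' ha1 hcont ⟨hsol.ya, hsol.y2pos.le⟩
    exact ⟨x, hx, hx0⟩
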